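/- The function F_I is positive on (0,∞), and there exists a constant C > 0 such that for all integers n ≥ 1 and all integers k with 0 ≤ k < n, |λ_{n,k} − 2^k · F_I(2^{−k} n)| ≤ C. (That is, the expected internal profile of a random symmetric digital search tree satisfies E(I_{n,k}) = 2^k F_I(2^{−k} n) + O(1) uniformly for 0 ≤ k < n.) -/

import Mathlib

open Filter Real

/-- `Q j = ∏_{ℓ=1}^{j} (1 - 2^{-ℓ})`. -/
noncomputable def Q (j : ℕ) : ℝ := ∏ l ∈ Finset.range j, (1 - (2:ℝ)^(-(l:ℤ)-1))

/-- `Q_∞ = ∏_{ℓ≥1} (1 - 2^{-ℓ})`. -/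
noncomputable def Qinf : ℝ := ∏' l : ℕ, (1 - (2:ℝ)^(-(l:ℤ)-1))

/-- `F_I(x) = 1 − ∑_{j≥0} (-1)^j 2^{-j(j+1)/2} e^{-2^j x} / (Q_j Q_∞)`. -/
noncomputable def FI (x : ℝ) : ℝ :=
  1 - ∑' j : ℕ, (-1:ℝ)^j * ((2:ℝ)^((j+1).choose 2))⁻¹ * Real.exp (-(2:ℝ)^j * x) / (Q j * Qinf)

/-- Expected internal profile `λ_{n,k}` of a random symmetric digital search tree. -/
noncomputable def lam : ℕ → ℕ → ℝ
  | n, 0 => if n = 0 then 0 else 1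
  | n, k + 1 => (2:ℝ)^((2:ℤ) - (n:ℤ)) *
      ∑ j ∈ Finset.range n, ((n-1).choose j : ℝ) * lam j k

lemma zq (l : ℕ) : (2:ℝ)^(-(l:ℤ)-1) = (1/2:ℝ)^(l+1) := by
  rw [show (-(l:ℤ)-1) = -((l+1:ℕ):ℤ) by push_cast; ring, zpow_neg, zpow_natCast, one_div, inv_pow]

lemma Q_zero : Q 0 = 1 := by simp [Q]

lemma Q_succ (m : ℕ) : Q (m+1) = Q m * (1 - (1/2:ℝ)^(m+1)) := by
  simp only [Q, Finset.prod_range_succ, zq]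

lemma half_lt (m : ℕ) : (1/2:ℝ)^(m+1) < 1 := pow_lt_one₀ (by norm_num) (by norm_num) (by omega)

lemma Q_pos (m : ℕ) : 0 < Q m := by
  induction m with
  | zero => simp [Q_zero]
  | succ m ih => rw [Q_succ]; exact mul_pos ih (by linarith [half_lt m])

lemma Q_anti : Antitone Q := by
  apply antitone_nat_of_succ_le
  intro m
  rw [Q_succ]
  have : 0 < (1/2:ℝ)^(m+1) := by positivity
  nlinarith [Q_pos m]

lemma Q_lower (m r : ℕ) : Q m * (1 - (1/2:ℝ)^m + (1/2:ℝ)^(m+r)) ≤ Q (m+r) := by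
  induction r with
  | zero => simp
  | succ r ih =>
    rw [← add_assoc, Q_succ]
    have h1 := half_lt (m+r)
    have h2 : (1/2:ℝ)^(m+r+1) = (1/2:ℝ)^(m+r)/2 := by rw [pow_succ]; ring
    have h3 : (1/2:ℝ)^(m+r) ≤ (1/2:ℝ)^m := pow_le_pow_of_le_one (by norm_num) (by norm_num) (by omega)
    have h4 : 0 < (1/2:ℝ)^(m+r) := by positivity
    refine le_trans ?_ (mul_le_mul_of_nonneg_right ih (by linarith))
    rw [h2, mul_assoc]
    refine mul_le_mul_of_nonneg_left ?_ (Q_pos m).le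
    nlinarith [mul_nonneg h4.le (sub_nonneg.2 h3)]

lemma Q_tendsto : Tendsto Q atTop (nhds Qinf) := by
  have hs : Summable (fun l : ℕ => -(1/2:ℝ)^(l+1)) := by
    have := (summable_nat_add_iff 1).2 (summable_geometric_of_lt_one (r := (1/2:ℝ)) (by norm_num) (by norm_num))
    exact this.neg
  have h : Multipliable (fun l : ℕ => (1 - (2:ℝ)^(-(l:ℤ)-1))) := by
    have := Real.multipliable_one_add_of_summable hs
    simp only [zq]
    simpa only [sub_eq_add_neg] using this
  exact h.hasProd.tendsto_prod_nat

lemma Qinf_le (m : ℕ) : Qinf ≤ Q m := Q_anti.le_of_tendsto Q_tendsto m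

lemma Qinf_ge (m : ℕ) : Q m * (1 - (1/2:ℝ)^m) ≤ Qinf := by
  refine ge_of_tendsto Q_tendsto ?_
  filter_upwards [eventually_ge_atTop m] with t ht
  obtain ⟨r, rfl⟩ := Nat.exists_eq_add_of_le ht
  refine le_trans ?_ (Q_lower m r)
  refine mul_le_mul_of_nonneg_left ?_ (Q_pos m).le
  have : 0 < (1/2:ℝ)^(m+r) := by positivity
  linarith

lemma Qinf_ge4 : 1/4 ≤ Qinf := by
  have := Qinf_ge 1
  rw [Q_succ, Q_zero] at this
  norm_num at this ⊢
  exact this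

lemma Qinf_pos : 0 < Qinf := by linarith [Qinf_ge4]

lemma Qinv_inf_le : Qinf⁻¹ ≤ 4 := by
  rw [inv_le_comm₀ Qinf_pos (by norm_num)]; linarith [Qinf_ge4]

lemma Qinv_le (m : ℕ) : (Q m)⁻¹ ≤ 4 :=
  (inv_anti₀ Qinf_pos (Qinf_le m)).trans Qinv_inf_le

lemma Qinv_diff (m : ℕ) : |(Q m)⁻¹ - Qinf⁻¹| ≤ 4 * (1/2:ℝ)^m := by
  have h1 := inv_anti₀ Qinf_pos (Qinf_le m)
  rw [abs_sub_comm, abs_of_nonneg (by linarith)]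
  have h2 := Qinf_ge m
  have hq := Q_pos m
  have hi := Qinf_pos
  have h3 : Qinf⁻¹ - (Q m)⁻¹ = (1 - Qinf / Q m) * Qinf⁻¹ := by field_simp
  have h4 : 1 - (1/2:ℝ)^m ≤ Qinf / Q m := by rw [le_div_iff₀ hq]; linarith
  have h5 : Qinf / Q m ≤ 1 := by rw [div_le_one hq]; exact Qinf_le m
  rw [h3, mul_comm 4]
  exact mul_le_mul (by linarith) Qinv_inf_le (inv_pos.2 hi).le (by positivity)

noncomputable def aa (j : ℕ) : ℝ := (-1:ℝ)^j * ((2:ℝ)^((j+1).choose 2))⁻¹ / Q j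

lemma aa_zero : aa 0 = 1 := by simp [aa, Q_zero]

lemma aa_succ (j : ℕ) : aa (j+1) * (1 - (1/2:ℝ)^(j+1)) = -(1/2:ℝ)^(j+1) * aa j := by
  have h := half_lt j
  have hq := Q_pos j
  have h' : (1 - (1/2:ℝ)^(j+1)) ≠ 0 := by linarith
  unfold aa
  rw [Q_succ, show (j+1+1).choose 2 = (j+1) + (j+1).choose 2 by
    rw [Nat.choose_succ_succ' (j+1) 1]; simp, pow_add, pow_succ (-1:ℝ)]
  field_simp
  rw [one_div, inv_pow]
  field_simp
  rw [pow_add]; ring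

lemma aa_abs (j : ℕ) : |aa j| * 2^j ≤ 8 * (1/2:ℝ)^j := by
  have h : 2 * j ≤ (j+1).choose 2 + 1 := by
    induction j with
    | zero => simp
    | succ j ih =>
      rw [Nat.choose_succ_succ' (j+1) 1]
      rcases j with _ | j
      · simp
      · simp at *; omega
  have h1 : |aa j| = ((2:ℝ)^((j+1).choose 2))⁻¹ * (Q j)⁻¹ := by
    unfold aa
    rw [abs_div, abs_mul, abs_pow, abs_neg, abs_one, one_pow, one_mul, abs_of_pos (Q_pos j),
      abs_of_pos (by positivity), div_eq_mul_inv]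
  have h2 : (2:ℝ)^j * 2^j ≤ 2^((j+1).choose 2) * 2 := by
    rw [← pow_add, ← pow_succ]
    exact pow_le_pow_right₀ (by norm_num) (by omega)
  have h3 : ((2:ℝ)^((j+1).choose 2))⁻¹ * 2^j ≤ 2 * (1/2:ℝ)^j := by
    rw [one_div, inv_pow]
    field_simp
    nlinarith
  rw [h1]
  have := Qinv_le j
  have h0 : 0 ≤ (Q j)⁻¹ := (inv_pos.2 (Q_pos j)).le
  have h5 := mul_le_mul h3 this h0 (by positivity)
  nlinarith

lemma conv_one (k : ℕ) : ∑ p ∈ Finset.HasAntidiagonal.antidiagonal k, aa p.1 * (Q p.2)⁻¹ = 1 := by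
  induction k with
  | zero => simp [aa_zero, Q_zero]
  | succ k ih =>
    have h := half_lt k
    have hk : (1 - (1/2:ℝ)^(k+1)) ≠ 0 := by linarith
    apply mul_left_cancel₀ hk
    have e1 : (1 - (1/2:ℝ)^(k+1)) * ∑ p ∈ Finset.HasAntidiagonal.antidiagonal (k+1), aa p.1 * (Q p.2)⁻¹
        = ∑ p ∈ Finset.HasAntidiagonal.antidiagonal (k+1), aa p.1 * ((Q p.2)⁻¹ * (1 - (1/2:ℝ)^p.2))
        + ∑ p ∈ Finset.HasAntidiagonal.antidiagonal (k+1), (aa p.1 * (1 - (1/2:ℝ)^p.1)) * ((Q p.2)⁻¹ * (1/2:ℝ)^p.2) := by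
      rw [Finset.mul_sum, ← Finset.sum_add_distrib]
      apply Finset.sum_congr rfl
      intro p hp
      rw [← Finset.HasAntidiagonal.mem_antidiagonal.1 hp, pow_add]
      ring
    rw [e1, Finset.Nat.sum_antidiagonal_succ', Finset.Nat.sum_antidiagonal_succ]
    simp only [pow_zero, sub_self, mul_zero, zero_mul, zero_add]
    have e2 : ∀ m, (Q (m+1))⁻¹ * (1 - (1/2:ℝ)^(m+1)) = (Q m)⁻¹ := by
      intro m
      have := half_lt m
      have h' : (1 - (1/2:ℝ)^(m+1)) ≠ 0 := by linarith
      rw [Q_succ, mul_inv, mul_assoc, inv_mul_cancel₀ h', mul_one]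
    have e3 : ∑ p ∈ Finset.HasAntidiagonal.antidiagonal k, (aa (p.1+1) * (1 - (1/2:ℝ)^(p.1+1))) * ((Q p.2)⁻¹ * (1/2:ℝ)^p.2)
       = -(1/2:ℝ)^(k+1) * ∑ p ∈ Finset.HasAntidiagonal.antidiagonal k, aa p.1 * (Q p.2)⁻¹ := by
      rw [Finset.mul_sum]
      apply Finset.sum_congr rfl
      intro p hp
      rw [← Finset.HasAntidiagonal.mem_antidiagonal.1 hp, aa_succ]
      ring
    rw [e3]
    simp only [e2, ih]
    ring

lemma binom_half (n : ℕ) (x : ℝ) :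
    (2:ℝ)^((1:ℤ) - (n:ℤ)) * ∑ j ∈ Finset.range (n+1), (n.choose j : ℝ) * x^j = 2 * ((1+x)/2)^n := by
  rw [zpow_sub₀ (by norm_num), zpow_one, zpow_natCast, div_pow, add_comm 1 x, add_pow]
  simp only [one_pow, mul_one]
  rw [Finset.sum_congr rfl (fun j _ => mul_comm _ _)]
  ring

lemma lam_formula (k n : ℕ) : lam n k = 2^k * (1 - ∑ p ∈ Finset.HasAntidiagonal.antidiagonal k,
    aa p.1 * (Q p.2)⁻¹ * (1 - (1/2:ℝ)^p.2)^n) := by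
  induction k generalizing n with
  | zero =>
    rcases n with _ | n <;> simp [lam, aa_zero, Q_zero]
  | succ k ih =>
    rcases n with _ | n
    · simp [lam, conv_one]
    · rw [lam]
      simp only [ih, Nat.add_sub_cancel]
      have e0 : (2:ℤ) - ((n+1:ℕ):ℤ) = 1 - n := by push_cast; ring
      rw [e0]
      have e1 : ∑ j ∈ Finset.range (n+1), (n.choose j : ℝ) * (2^k * (1 - ∑ p ∈ Finset.HasAntidiagonal.antidiagonal k,
          aa p.1 * (Q p.2)⁻¹ * (1 - (1/2:ℝ)^p.2)^j))
        = 2^k * (∑ j ∈ Finset.range (n+1), (n.choose j : ℝ) * 1^j - ∑ p ∈ Finset.HasAntidiagonal.antidiagonal k,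
          aa p.1 * (Q p.2)⁻¹ * ∑ j ∈ Finset.range (n+1), (n.choose j : ℝ) * (1 - (1/2:ℝ)^p.2)^j) := by
        simp only [Finset.mul_sum, mul_sub, Finset.sum_sub_distrib]
        rw [Finset.sum_comm]
        congr 1
        · apply Finset.sum_congr rfl; intros; ring
        · apply Finset.sum_congr rfl; intros
          apply Finset.sum_congr rfl; intros; ring
      rw [e1, Finset.Nat.sum_antidiagonal_succ']
      have e2 : ∀ p : ℕ × ℕ, aa p.1 * (Q (p.2+1))⁻¹ * (1 - (1/2:ℝ)^(p.2+1))^(n+1) =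
          aa p.1 * (Q p.2)⁻¹ * ((1 + (1 - (1/2:ℝ)^p.2))/2)^n := by
        intro p
        have := half_lt p.2
        have h' : (1 - (1/2:ℝ)^(p.2+1)) ≠ 0 := by linarith
        have : (1 + (1 - (1/2:ℝ)^p.2))/2 = 1 - (1/2:ℝ)^(p.2+1) := by rw [pow_succ]; ring
        rw [this, Q_succ, mul_inv, pow_succ (1 - (1/2:ℝ)^(p.2+1))]
        have hq := (Q_pos p.2).ne'
        generalize (1 - (1/2:ℝ)^(p.2+1)) = y at *
        field_simp
      simp only [e2, pow_zero, sub_self, ne_eq, Nat.succ_ne_zero, not_false_eq_true, zero_pow, mul_zero, zero_add]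
      rw [mul_left_comm, mul_sub, binom_half, Finset.mul_sum]
      simp only [mul_left_comm _ (aa _ * _), binom_half]
      rw [← Finset.sum_congr rfl (fun p _ => mul_left_comm 2 (aa p.1 * (Q p.2)⁻¹) _), ← Finset.mul_sum, pow_succ]
      norm_num
      ring

lemma exp_diff (n : ℕ) (x : ℝ) (h0 : 0 ≤ x) (h1 : x ≤ 1) : |(1-x)^n - exp (-(x*n))| ≤ x := by
  have e : exp (-(x*n)) = exp (-x)^n := by rw [← Real.exp_nat_mul]; congr 1; ring
  have hle : (1-x)^n ≤ exp (-(x*n)) := by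
    rw [e]; exact pow_le_pow_left₀ (by linarith) (Real.one_sub_le_exp_neg x) n
  rw [abs_sub_comm, abs_of_nonneg (by linarith)]
  have h2 : 1 - n * x^2 ≤ ((1-x) * exp x)^n := by
    have hb := one_add_mul_le_pow (a := -x^2) (by nlinarith) n
    have hc : (1 + -x^2)^n ≤ ((1-x) * exp x)^n := by
      apply pow_le_pow_left₀ (by nlinarith)
      nlinarith [Real.add_one_le_exp x]
    nlinarith
  have h3 : exp (-(x*n)) * (1 - n*x^2) ≤ (1-x)^n := by
    calc _ ≤ exp (-(x*n)) * ((1-x) * exp x)^n := mul_le_mul_of_nonneg_left h2 (exp_pos _).le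
      _ = _ := by
        rw [e, mul_pow, mul_left_comm, ← mul_pow, ← Real.exp_add]; simp
  have h4 : (x*n) * exp (-(x*n)) ≤ 1 := by
    rw [Real.exp_neg, ← div_eq_mul_inv, div_le_one (exp_pos _)]
    linarith [Real.add_one_le_exp (x*n)]
  nlinarith

lemma FI_eq (x : ℝ) : FI x = 1 - ∑' j : ℕ, aa j * Qinf⁻¹ * exp (-(2:ℝ)^j * x) := by
  unfold FI aa
  congr 1
  apply tsum_congr
  intro j
  rw [div_eq_mul_inv, div_eq_mul_inv, mul_inv]; ring

lemma geo_hasSum : HasSum (fun j : ℕ => 64 * (1/2:ℝ)^j) 128 := by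
  have := hasSum_geometric_two.mul_left 64
  norm_num at this ⊢
  exact this

lemma exp_le1 (j : ℕ) (x : ℝ) (hx : 0 ≤ x) : exp (-(2:ℝ)^j * x) ≤ 1 := by
  rw [Real.exp_le_one_iff]
  have : 0 ≤ (2:ℝ)^j * x := by positivity
  linarith

lemma aa_abs' (j : ℕ) : |aa j| * 2^j * 8 ≤ 64 * (1/2:ℝ)^j := by linarith [aa_abs j]

lemma term_bound' (j : ℕ) (x : ℝ) (hx : 0 ≤ x) :
    ‖aa j * Qinf⁻¹ * exp (-(2:ℝ)^j * x)‖ * 2^j ≤ 64 * (1/2:ℝ)^j := by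
  rw [norm_mul, norm_mul, Real.norm_eq_abs, Real.norm_eq_abs, Real.norm_eq_abs, abs_of_pos (inv_pos.2 Qinf_pos),
    abs_of_pos (exp_pos _)]
  have h1 : Qinf⁻¹ * exp (-(2:ℝ)^j * x) ≤ 4 * 1 :=
    mul_le_mul Qinv_inf_le (exp_le1 j x hx) (exp_pos _).le (by norm_num)
  have h2 : 0 ≤ |aa j| * 2^j := by positivity
  have := aa_abs' j
  nlinarith [mul_le_mul_of_nonneg_left h1 h2]

lemma term_bound (j : ℕ) (x : ℝ) (hx : 0 ≤ x) :
    ‖aa j * Qinf⁻¹ * exp (-(2:ℝ)^j * x)‖ ≤ 64 * (1/2:ℝ)^j := by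
  refine le_trans ?_ (term_bound' j x hx)
  exact le_mul_of_one_le_right (norm_nonneg _) (one_le_pow₀ (by norm_num))

lemma term_summable (x : ℝ) (hx : 0 ≤ x) :
    Summable (fun j : ℕ => aa j * Qinf⁻¹ * exp (-(2:ℝ)^j * x)) :=
  Summable.of_norm_bounded geo_hasSum.summable (fun j => term_bound j x hx)

lemma main_bound (n k : ℕ) : |lam n k - (2:ℝ)^k * FI ((2:ℝ)^(-(k:ℤ)) * n)| ≤ 128 := by
  rw [FI_eq, lam_formula]
  set x : ℝ := (2:ℝ)^(-(k:ℤ)) * n with hx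
  have hx0 : 0 ≤ x := by positivity
  set w : ℕ → ℝ := fun j => if j < k + 1 then aa j * (Q (k-j))⁻¹ * (1 - (1/2:ℝ)^(k-j))^n else 0 with hw
  have e1 : ∑ p ∈ Finset.HasAntidiagonal.antidiagonal k, aa p.1 * (Q p.2)⁻¹ * (1 - (1/2:ℝ)^p.2)^n = ∑' j, w j := by
    rw [Finset.Nat.sum_antidiagonal_eq_sum_range_succ_mk, tsum_eq_sum (s := Finset.range (k+1))]
    · apply Finset.sum_congr rfl
      intro j hj
      simp only [hw, Finset.mem_range.1 hj, if_true]
    · intro j hj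
      simp only [Finset.mem_range] at hj
      simp only [hw, hj, if_false]
  have hws : Summable w := by
    apply summable_of_ne_finset_zero (s := Finset.range (k+1))
    intro j hj
    simp only [Finset.mem_range] at hj
    simp only [hw, hj, if_false]
  have e2 : (2:ℝ)^k * (1 - ∑' j, w j) - 2^k * (1 - ∑' j : ℕ, aa j * Qinf⁻¹ * exp (-(2:ℝ)^j * x))
      = ∑' j, 2^k * (aa j * Qinf⁻¹ * exp (-(2:ℝ)^j * x) - w j) := by
    rw [tsum_mul_left, (term_summable x hx0).tsum_sub hws]; ring
  rw [e1, e2, ← Real.norm_eq_abs]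
  refine tsum_of_norm_bounded geo_hasSum ?_
  intro j
  by_cases hj : j < k + 1
  · obtain ⟨m, rfl⟩ := Nat.exists_eq_add_of_le (Nat.lt_succ_iff.1 hj)
    simp only [hw, hj, if_true, Nat.add_sub_cancel_left]
    have hex : -(2:ℝ)^j * x = -((1/2:ℝ)^m * n) := by
      rw [hx, zpow_neg, zpow_natCast, one_div, inv_pow, pow_add]
      field_simp
    rw [hex]
    have hm0 : 0 < (1/2:ℝ)^m := by positivity
    have hm1 : (1/2:ℝ)^m ≤ 1 := pow_le_one₀ (by norm_num) (by norm_num)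
    have hd := exp_diff n _ hm0.le hm1
    have hQ := Qinv_diff m
    have hp : |(1 - (1/2:ℝ)^m)^n| ≤ 1 := by
      rw [abs_of_nonneg (pow_nonneg (by linarith) _)]
      exact pow_le_one₀ (by linarith) (by linarith)
    have e3 : 2^(j+m) * (aa j * Qinf⁻¹ * exp (-((1/2:ℝ)^m * n)) - aa j * (Q m)⁻¹ * (1 - (1/2:ℝ)^m)^n)
      = (2^(j+m) * aa j) * (-(Qinf⁻¹ * ((1 - (1/2:ℝ)^m)^n - exp (-((1/2:ℝ)^m * n))))
          - ((Q m)⁻¹ - Qinf⁻¹) * (1 - (1/2:ℝ)^m)^n) := by ring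
    rw [e3, norm_mul, Real.norm_eq_abs, Real.norm_eq_abs, abs_mul, abs_of_pos (by positivity : (0:ℝ) < 2^(j+m))]
    have h5 : |-(Qinf⁻¹ * ((1 - (1/2:ℝ)^m)^n - exp (-((1/2:ℝ)^m * n))))
          - ((Q m)⁻¹ - Qinf⁻¹) * (1 - (1/2:ℝ)^m)^n| ≤ 8 * (1/2:ℝ)^m := by
      refine (abs_sub _ _).trans ?_
      rw [abs_neg, abs_mul, abs_mul, abs_of_pos (inv_pos.2 Qinf_pos)]
      have := mul_le_mul Qinv_inf_le hd (abs_nonneg _) (by norm_num)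
      have := mul_le_mul hQ hp (abs_nonneg _) (by positivity)
      linarith
    refine (mul_le_mul_of_nonneg_left h5 (by positivity)).trans ?_
    refine le_trans (le_of_eq ?_) (aa_abs' j)
    rw [pow_add, one_div, inv_pow]
    field_simp
  · simp only [hw, hj, if_false, sub_zero]
    refine le_trans ?_ (term_bound' j x hx0)
    rw [norm_mul, mul_comm]
    refine mul_le_mul_of_nonneg_left ?_ (norm_nonneg _)
    rw [Real.norm_eq_abs, abs_of_pos (by positivity)]
    exact pow_le_pow_right₀ (by norm_num) (by omega)

lemma FI_zero : FI 0 = 0 := by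
  by_contra h
  have h1 : 0 < |FI 0| := abs_pos.2 h
  obtain ⟨k, hk⟩ := pow_unbounded_of_one_lt (128 / |FI 0|) (by norm_num : (1:ℝ) < 2)
  have h2 := main_bound 0 k
  have h3 : lam 0 k = 0 := by cases k <;> simp [lam]
  rw [h3, Nat.cast_zero, mul_zero, zero_sub, abs_neg, abs_mul, abs_of_pos (by positivity : (0:ℝ) < 2^k)] at h2
  rw [div_lt_iff₀ h1] at hk
  linarith

lemma FI_cont : ContinuousOn FI (Set.Ici 0) := by
  have : FI = fun x => 1 - ∑' j : ℕ, aa j * Qinf⁻¹ * exp (-(2:ℝ)^j * x) := funext FI_eq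
  rw [this]
  refine continuousOn_const.sub (continuousOn_tsum (fun j => ?_) geo_hasSum.summable (fun j x hx => term_bound j x hx))
  fun_prop

lemma FI_deriv (x : ℝ) (hx : 0 < x) : HasDerivAt FI (FI (2*x) - FI x) x := by
  have e : FI = fun x => 1 - ∑' j : ℕ, aa j * Qinf⁻¹ * exp (-(2:ℝ)^j * x) := funext FI_eq
  have h := hasDerivAt_tsum_of_isPreconnected (g := fun (j:ℕ) (x:ℝ) => aa j * Qinf⁻¹ * exp (-(2:ℝ)^j * x))
    (g' := fun (j:ℕ) (x:ℝ) => (aa j * Qinf⁻¹ * exp (-(2:ℝ)^j * x)) * -(2:ℝ)^j)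
    (t := Set.Ioi 0) (y₀ := x) (y := x) geo_hasSum.summable isOpen_Ioi isPreconnected_Ioi
    (fun j y _ => by
      have := (((hasDerivAt_id y).const_mul (-(2:ℝ)^j)).exp).const_mul (aa j * Qinf⁻¹)
      convert! this using 1
      simp; ring)
    (fun j y hy => by
      have := term_bound' j y (le_of_lt hy)
      rw [norm_mul, norm_neg, Real.norm_eq_abs ((2:ℝ)^j), abs_of_pos (by positivity : (0:ℝ) < 2^j)]
      exact this)
    hx (term_summable x hx.le) hx
  have h2 := h.const_sub 1
  rw [← e] at h2
  convert! h2 using 1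
  have s1 := term_summable x hx.le
  have s2 := term_summable (2*x) (by linarith)
  have s3 : Summable (fun j : ℕ => (aa j * Qinf⁻¹ * exp (-(2:ℝ)^j * x)) * -(2:ℝ)^j) := by
    refine Summable.of_norm_bounded geo_hasSum.summable (fun j => ?_)
    have := term_bound' j x hx.le
    rw [norm_mul, norm_neg, Real.norm_eq_abs ((2:ℝ)^j), abs_of_pos (by positivity : (0:ℝ) < 2^j)]
    exact this
  rw [FI_eq, FI_eq, s1.tsum_eq_zero_add, s3.tsum_eq_zero_add]
  have : ∑' j : ℕ, aa j * Qinf⁻¹ * exp (-(2:ℝ)^j * (2*x)) =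
      ∑' j : ℕ, (aa (j+1) * Qinf⁻¹ * exp (-(2:ℝ)^(j+1) * x) +
        aa (j+1) * Qinf⁻¹ * exp (-(2:ℝ)^(j+1) * x) * -(2:ℝ)^(j+1)) := by
    apply tsum_congr
    intro j
    have e1 : -(2:ℝ)^j * (2*x) = -(2:ℝ)^(j+1) * x := by rw [pow_succ]; ring
    have e2 : aa j = aa (j+1) - 2^(j+1) * aa (j+1) := by
      have := aa_succ j
      rw [one_div, inv_pow] at this
      field_simp at this
      linarith
    rw [e1, e2]; ring
  rw [this, Summable.tsum_add ((summable_nat_add_iff 1).2 s1) ((summable_nat_add_iff 1).2 s3)]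
  simp only [pow_zero]
  ring

lemma FI_tendsto : Tendsto FI atTop (nhds 1) := by
  have e : FI = fun x => 1 - ∑' j : ℕ, aa j * Qinf⁻¹ * exp (-(2:ℝ)^j * x) := funext FI_eq
  rw [e]
  have h := tendsto_tsum_of_dominated_convergence (𝓕 := atTop)
    (f := fun (x:ℝ) (j:ℕ) => aa j * Qinf⁻¹ * exp (-(2:ℝ)^j * x)) (g := fun _ => 0)
    geo_hasSum.summable (fun j => by
      have : Tendsto (fun x : ℝ => -(2:ℝ)^j * x) atTop atBot :=
        tendsto_id.const_mul_atTop_of_neg (by simp)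
      simpa using (Real.tendsto_exp_atBot.comp this).const_mul (aa j * Qinf⁻¹))
    (by filter_upwards [eventually_ge_atTop 0] with x hx j using term_bound j x hx)
  simpa using h.const_sub 1

lemma FI_min (y : ℝ) (hy : 0 < y) (hle : FI y ≤ 0) (hmin : ∀ z, 0 ≤ z → FI y ≤ FI z) : False := by
  have h : ∀ m : ℕ, FI (2^m * y) = FI y := by
    intro m
    induction m with
    | zero => simp
    | succ m ih =>
      have hp : 0 < 2^m * y := by positivity
      have hloc : IsLocalMin FI (2^m * y) := by
        filter_upwards [lt_mem_nhds hp] with z hz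
        rw [ih]; exact hmin z hz.le
      have := hloc.hasDerivAt_eq_zero (FI_deriv _ hp)
      rw [pow_succ, show (2:ℝ)^m * 2 * y = 2 * (2^m * y) by ring]
      linarith
  have ht : Tendsto (fun m : ℕ => (2:ℝ)^m * y) atTop atTop :=
    (tendsto_pow_atTop_atTop_of_one_lt (by norm_num)).atTop_mul_const hy
  have h2 := FI_tendsto.comp ht
  have h3 : Tendsto (fun _ : ℕ => FI y) atTop (nhds 1) := by
    refine h2.congr (fun m => ?_)
    exact h m
  have := tendsto_nhds_unique h3 tendsto_const_nhds
  linarith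

lemma FI_pos (x : ℝ) (hx : 0 < x) : 0 < FI x := by
  by_contra! hc
  obtain ⟨M, hM⟩ := eventually_atTop.1 (FI_tendsto.eventually (lt_mem_nhds (by norm_num : (0:ℝ) < 1)))
  have hxM : x < M := by
    by_contra! h
    linarith [hM x h]
  obtain ⟨y, hy, hmin⟩ := isCompact_Icc.exists_isMinOn (s := Set.Icc 0 M) ⟨x, hx.le, hxM.le⟩
    (FI_cont.mono (fun z hz => hz.1))
  have hyx : FI y ≤ FI x := hmin ⟨hx.le, hxM.le⟩
  have hall : ∀ z, 0 ≤ z → FI y ≤ FI z := by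
    intro z hz
    rcases le_total z M with h | h
    · exact hmin ⟨hz, h⟩
    · linarith [hM z h]
  rcases hy.1.eq_or_lt with h | h
  · subst h
    have h0 := FI_zero
    exact FI_min x hx hc (fun z hz => by linarith [hall z hz])
  · exact FI_min y h (by linarith) hall

/-- `F_I` is positive on `(0,∞)` and
`E(I_{n,k}) = 2^k F_I(2^{-k} n) + O(1)` uniformly for `0 ≤ k < n`. -/
theorem mean_internal_profile :
    (∀ x : ℝ, 0 < x → 0 < FI x) ∧
    ∃ C > (0:ℝ), ∀ n k : ℕ, 1 ≤ n → k < n →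
      |lam n k - (2:ℝ)^k * FI ((2:ℝ)^(-(k:ℤ)) * n)| ≤ C := by
  exact ⟨FI_pos, 128, by norm_num, fun n k _ _ => main_bound n k⟩
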